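/- Let 0<q<1 and v>-1. For every f ∈ L_{q,1,v} and every x, y ∈ ℝ_q^+, the q-translation operator has the kernel representation T_{q,x}^v f(y) = ∫_0^∞ f(z) D_v(x,y,z) z^{2v+1} d_q z. -/

import Mathlib

open scoped BigOperators

noncomputable section

/-- Finite q-Pochhammer symbol `(a;q)_n = ∏_{i=0}^{n-1} (1 - a q^i)`. -/
def qPoch (a q : ℝ) (n : ℕ) : ℝ := ∏ i ∈ Finset.range n, (1 - a * q ^ i)

/-- Infinite q-Pochhammer symbol `(a;q)_∞ = ∏_{i=0}^{∞} (1 - a q^i)`. -/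
def qPochInf (a q : ℝ) : ℝ := ∏' i : ℕ, (1 - a * q ^ i)

/-- Normalized Hahn–Exton q-Bessel function `j_v(x,q²)`. -/
def jHE (q v x : ℝ) : ℝ :=
  ∑' n : ℕ, (-1 : ℝ) ^ n * q ^ (n * (n + 1)) * x ^ (2 * n) /
    (qPoch (q ^ 2) (q ^ 2) n * qPoch (q ^ (2 * v + 2)) (q ^ 2) n)

/-- Hahn–Exton q-Bessel function with base `p`:
`J_v(x,p) = (x^v/(p;p)_∞) Σ_{n} (-1)^n p^{n(n+1)/2} (p^{v+n+1};p)_∞ x^{2n}/(p;p)_n`.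
With `p = q²` this is `J_v(x,q²)`. -/
def JHE (p v x : ℝ) : ℝ :=
  (x ^ v / qPochInf p p) *
    ∑' n : ℕ, (-1 : ℝ) ^ n * p ^ (((n : ℝ) * ((n : ℝ) + 1)) / 2) *
      qPochInf (p ^ (v + (n : ℝ) + 1)) p * x ^ (2 * n) / qPoch p p n

/-- The constant `c_{q,v}`. -/
def cqv (q v : ℝ) : ℝ :=
  (1 / (1 - q)) * qPochInf (q ^ (2 * v + 2)) (q ^ 2) / qPochInf (q ^ 2) (q ^ 2)

/-- Jackson q-integral on `[0,∞)`: `∫_0^∞ f(x) d_q x = (1-q) Σ_{n∈ℤ} q^n f(q^n)`. -/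
def jackson (q : ℝ) (f : ℝ → ℝ) : ℝ := (1 - q) * ∑' n : ℤ, q ^ n * f (q ^ n)

/-- The q-lattice `ℝ_q^+ = {q^n : n ∈ ℤ}`. -/
def Rq (q : ℝ) : Set ℝ := {x | ∃ n : ℤ, x = q ^ n}

/-- Membership in `L_{q,1,v}`: the Jackson integral `∫_0^∞ |f(x)| x^{2v+1} d_q x`
converges (absolutely). -/
def memL1 (q v : ℝ) (f : ℝ → ℝ) : Prop :=
  Summable fun n : ℤ => q ^ n * |f (q ^ n)| * (q ^ n) ^ (2 * v + 1 : ℝ)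

/-- q-Bessel Fourier transform `F_{q,v}`. -/
def qFourier (q v : ℝ) (f : ℝ → ℝ) (x : ℝ) : ℝ :=
  cqv q v * jackson q fun t => f t * jHE q v (x * t) * t ^ (2 * v + 1 : ℝ)

/-- q-translation operator `T_{q,x}^v`. -/
def qTrans (q v x : ℝ) (f : ℝ → ℝ) (y : ℝ) : ℝ :=
  cqv q v * jackson q fun t =>
    qFourier q v f t * jHE q v (x * t) * jHE q v (y * t) * t ^ (2 * v + 1 : ℝ)

/-- The kernel `D_v(x,y,z)`. -/
def Dker (q v x y z : ℝ) : ℝ :=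
  (cqv q v) ^ 2 * jackson q fun t =>
    jHE q v (x * t) * jHE q v (y * t) * jHE q v (z * t) * t ^ (2 * v + 1 : ℝ)

/-- Positivity of the q-translation operator `T_{q,x}^v`. -/
def IsPosT (q v x : ℝ) : Prop :=
  ∀ f : ℝ → ℝ, memL1 q v f → (∀ y ∈ Rq q, 0 ≤ f y) → ∀ y ∈ Rq q, 0 ≤ qTrans q v x f y

/-- The positivity domain `Q_v`. -/
def Qset (v : ℝ) : Set ℝ :=
  {q | q ∈ Set.Ioo (0 : ℝ) 1 ∧ ∀ x ∈ Rq q, IsPosT q v x}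

/-- The kernel `E_{v,x}(q^m,q^z,q^k)`. -/
def Ekern (q v x : ℝ) (m z k : ℤ) : ℝ :=
  (1 / ((1 - q) ^ 2 * cqv q v * cqv q (x - v))) *
    q ^ (-(k : ℝ) * (x + 2) - (m : ℝ) * v - (z : ℝ) * (x - v)) *
    JHE (q ^ 2) ((z : ℝ) - (k : ℝ)) (q ^ (x - v + (m : ℝ) - (k : ℝ))) *
    JHE (q ^ 2) (v + (z : ℝ) - (k : ℝ)) (q ^ ((m : ℝ) - (k : ℝ)))

/-- The function `q ↦ ₁φ₁(0;q;q,q) = Σ_{n} (-1)^n q^{n(n+1)/2} q^n /((q;q)_n)²`. -/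
def phiQ (q : ℝ) : ℝ :=
  ∑' n : ℕ, (-1 : ℝ) ^ n * q ^ (((n : ℝ) * ((n : ℝ) + 1)) / 2) * q ^ n / (qPoch q q n) ^ 2

/-- The coefficients `(-1)^n q^{n(n+1)} / (q²;q²)_n` of the power series of `(q² z;q²)_∞`. -/
def eulerCoeff (q : ℝ) (n : ℕ) : ℝ :=
  (-1 : ℝ) ^ n * q ^ (n * (n + 1)) / qPoch (q ^ 2) (q ^ 2) n

/-- Euler's power series for `(q² z;q²)_∞`. -/
def eulerSeries (q z : ℝ) : ℝ := ∑' n : ℕ, eulerCoeff q n * z ^ n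

lemma qPoch_succ (a p : ℝ) (n : ℕ) : qPoch a p (n + 1) = qPoch a p n * (1 - a * p ^ n) :=
  Finset.prod_range_succ _ _

lemma qPoch_pos {a p : ℝ} (ha0 : 0 ≤ a) (ha : a < 1) (hp0 : 0 ≤ p) (hp : p ≤ 1) (n : ℕ) :
    0 < qPoch a p n := by
  refine Finset.prod_pos fun i _ => ?_
  have h : p ^ i ≤ 1 := pow_le_one₀ hp0 hp
  have : a * p ^ i ≤ a := mul_le_of_le_one_right ha0 h
  linarith

lemma eulerCoeff_zero (q : ℝ) : eulerCoeff q 0 = 1 := by simp [eulerCoeff, qPoch]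

lemma eulerCoeff_succ {q : ℝ} (hq0 : 0 < q) (hq1 : q < 1) (n : ℕ) :
    eulerCoeff q (n + 1) * (1 - (q ^ 2) ^ (n + 1)) = -((q ^ 2) ^ (n + 1) * eulerCoeff q n) := by
  have hp1 : q ^ 2 < 1 := pow_lt_one₀ hq0.le hq1 two_ne_zero
  have h1 : qPoch (q ^ 2) (q ^ 2) n ≠ 0 := (qPoch_pos (by positivity) hp1 (by positivity) hp1.le n).ne'
  have h2 : 1 - (q ^ 2) ^ (n + 1) ≠ 0 :=
    (sub_pos.2 (pow_lt_one₀ (by positivity) hp1 (Nat.succ_ne_zero n))).ne'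
  have h3 : q ^ ((n + 1) * (n + 1 + 1)) = q ^ (n * (n + 1)) * (q ^ 2) ^ (n + 1) := by
    rw [← pow_mul, ← pow_add]; congr 1; ring
  have h4 : 1 - q ^ 2 * (q ^ 2) ^ n = 1 - (q ^ 2) ^ (n + 1) := by ring
  rw [eulerCoeff, eulerCoeff, qPoch_succ, h4, h3]
  generalize qPoch (q ^ 2) (q ^ 2) n = P at *
  generalize (q ^ 2) ^ (n + 1) = Q at *
  field_simp
  ring

lemma summable_abs_eulerCoeff_mul_pow {q : ℝ} (hq0 : 0 < q) (hq1 : q < 1) (z : ℝ) :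
    Summable fun n : ℕ => |eulerCoeff q n| * |z| ^ n := by
  have hp0 : 0 < q ^ 2 := by positivity
  have hp1 : q ^ 2 < 1 := pow_lt_one₀ hq0.le hq1 two_ne_zero
  have hlim : Filter.Tendsto (fun n : ℕ => (q ^ 2) ^ (n + 1) * |z| / (1 - q ^ 2))
      Filter.atTop (nhds 0) := by
    have := (tendsto_pow_atTop_nhds_zero_of_lt_one hp0.le hp1).comp (Filter.tendsto_add_atTop_nat 1)
    simpa using (this.mul_const |z|).div_const (1 - q ^ 2)
  refine summable_of_ratio_norm_eventually_le (r := 1 / 2) (by norm_num) ?_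
  filter_upwards [hlim.eventually (ge_mem_nhds (show (0 : ℝ) < 1 / 2 by norm_num))] with n hn
  have hle : (q ^ 2) ^ (n + 1) ≤ q ^ 2 := pow_le_of_le_one hp0.le hp1.le (Nat.succ_ne_zero n)
  have hd : 0 < 1 - q ^ 2 := sub_pos.2 hp1
  have hrec := congrArg abs (eulerCoeff_succ hq0 hq1 n)
  rw [abs_mul, abs_neg, abs_mul, abs_of_pos (show 0 < 1 - (q ^ 2) ^ (n + 1) by linarith),
    abs_of_pos (pow_pos hp0 (n + 1))] at hrec
  have hle2 : |eulerCoeff q (n + 1)| * (1 - q ^ 2) ≤ (q ^ 2) ^ (n + 1) * |eulerCoeff q n| := by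
    rw [← hrec]; gcongr
  have hle3 : |eulerCoeff q (n + 1)| ≤ (q ^ 2) ^ (n + 1) * |eulerCoeff q n| / (1 - q ^ 2) :=
    (le_div_iff₀ hd).2 hle2
  rw [Real.norm_of_nonneg (by positivity), Real.norm_of_nonneg (by positivity)]
  calc |eulerCoeff q (n + 1)| * |z| ^ (n + 1)
      ≤ ((q ^ 2) ^ (n + 1) * |eulerCoeff q n| / (1 - q ^ 2)) * |z| ^ (n + 1) := by gcongr
    _ = ((q ^ 2) ^ (n + 1) * |z| / (1 - q ^ 2)) * (|eulerCoeff q n| * |z| ^ n) := by ring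
    _ ≤ 1 / 2 * (|eulerCoeff q n| * |z| ^ n) := by gcongr

lemma summable_eulerCoeff_mul_pow {q : ℝ} (hq0 : 0 < q) (hq1 : q < 1) (z : ℝ) :
    Summable fun n : ℕ => eulerCoeff q n * z ^ n :=
  Summable.of_norm (by simpa [abs_mul] using summable_abs_eulerCoeff_mul_pow hq0 hq1 z)

lemma abs_eulerSeries_le {q : ℝ} (hq0 : 0 < q) (hq1 : q < 1) {z : ℝ} (hz : |z| ≤ 1) :
    |eulerSeries q z| ≤ ∑' n : ℕ, |eulerCoeff q n| := by
  have h1 : Summable fun n : ℕ => |eulerCoeff q n| := by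
    simpa using summable_abs_eulerCoeff_mul_pow hq0 hq1 1
  refine (Real.norm_eq_abs _).symm.trans_le (tsum_of_norm_bounded h1.hasSum fun n => ?_)
  rw [Real.norm_eq_abs, abs_mul, abs_pow]
  exact mul_le_of_le_one_right (abs_nonneg _) (pow_le_one₀ (abs_nonneg _) hz)

lemma eulerSeries_eq {q : ℝ} (hq0 : 0 < q) (hq1 : q < 1) (z : ℝ) :
    eulerSeries q z = (1 - q ^ 2 * z) * eulerSeries q (q ^ 2 * z) := by
  have hs := summable_eulerCoeff_mul_pow hq0 hq1 z
  have ht := summable_eulerCoeff_mul_pow hq0 hq1 (q ^ 2 * z)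
  have key : eulerSeries q z - eulerSeries q (q ^ 2 * z) =
      -(q ^ 2 * z) * eulerSeries q (q ^ 2 * z) := by
    rw [eulerSeries, eulerSeries, ← hs.tsum_sub ht, ← tsum_mul_left,
      (hs.sub ht).tsum_eq_zero_add]
    simp only [pow_zero, sub_self, zero_add]
    refine tsum_congr fun n => ?_
    have h := eulerCoeff_succ hq0 hq1 n
    calc _ = eulerCoeff q (n + 1) * (1 - (q ^ 2) ^ (n + 1)) * z ^ (n + 1) := by
            rw [mul_pow]; ring
      _ = _ := by rw [h, mul_pow]; ring
  linear_combination key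

lemma eulerSeries_eq_qPoch_mul {q : ℝ} (hq0 : 0 < q) (hq1 : q < 1) (z : ℝ) (n : ℕ) :
    eulerSeries q z = qPoch (q ^ 2 * z) (q ^ 2) n * eulerSeries q ((q ^ 2) ^ n * z) := by
  induction n with
  | zero => simp [qPoch]
  | succ n ih =>
    rw [ih, eulerSeries_eq hq0 hq1 ((q ^ 2) ^ n * z), qPoch_succ, pow_succ' (q ^ 2) n]
    simp only [mul_assoc]
    ring_nf

lemma tendsto_eulerSeries_pow_mul {q : ℝ} (hq0 : 0 < q) (hq1 : q < 1) (z : ℝ) :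
    Filter.Tendsto (fun n : ℕ => eulerSeries q ((q ^ 2) ^ n * z)) Filter.atTop (nhds 1) := by
  have hp0 : 0 < q ^ 2 := by positivity
  have hp1 : q ^ 2 < 1 := pow_lt_one₀ hq0.le hq1 two_ne_zero
  have hz : Filter.Tendsto (fun n : ℕ => (q ^ 2) ^ n * z) Filter.atTop (nhds 0) := by
    simpa using (tendsto_pow_atTop_nhds_zero_of_lt_one hp0.le hp1).mul_const z
  have h := tendsto_tsum_of_dominated_convergence (𝓕 := Filter.atTop)
    (f := fun (n : ℕ) (m : ℕ) => eulerCoeff q m * ((q ^ 2) ^ n * z) ^ m)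
    (g := fun m => eulerCoeff q m * 0 ^ m)
    (summable_abs_eulerCoeff_mul_pow hq0 hq1 z) (fun m => (hz.pow m).const_mul _)
    (Filter.Eventually.of_forall fun n m => by
      rw [Real.norm_eq_abs, abs_mul, abs_pow, abs_mul, abs_of_pos (pow_pos hp0 n)]
      gcongr
      exact mul_le_of_le_one_left (abs_nonneg _) (pow_le_one₀ hp0.le hp1.le))
  have h0 : ∑' m : ℕ, eulerCoeff q m * 0 ^ m = 1 := by
    rw [tsum_eq_single 0 fun m hm => by simp [hm]]
    simp [eulerCoeff_zero]
  rwa [h0] at h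

lemma eulerSeries_ne_zero {q : ℝ} (hq0 : 0 < q) (hq1 : q < 1) {z : ℝ} (hz0 : 0 ≤ z)
    (hz : q ^ 2 * z < 1) : eulerSeries q z ≠ 0 := by
  have hp1 : q ^ 2 < 1 := pow_lt_one₀ hq0.le hq1 two_ne_zero
  obtain ⟨n, hn⟩ := ((tendsto_eulerSeries_pow_mul hq0 hq1 z).eventually_ne one_ne_zero).exists
  rw [eulerSeries_eq_qPoch_mul hq0 hq1 z n]
  exact mul_ne_zero (qPoch_pos (by positivity) hz (by positivity) hp1.le n).ne' hn

lemma eulerSeries_zpow_neg {q : ℝ} (hq0 : 0 < q) (hq1 : q < 1) (n : ℕ) :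
    eulerSeries q ((q ^ 2) ^ (-(n + 1 : ℤ))) = 0 := by
  have hp0 : q ^ 2 ≠ 0 := by positivity
  induction n with
  | zero => rw [eulerSeries_eq hq0 hq1]; simp [hp0]
  | succ n ih =>
    have : q ^ 2 * (q ^ 2) ^ (-((n + 1 : ℕ) + 1 : ℤ)) = (q ^ 2) ^ (-(n + 1 : ℤ)) := by
      rw [← zpow_one_add₀ hp0]; congr 1
    rw [eulerSeries_eq hq0 hq1, this, ih, mul_zero]

lemma eulerSeries_mul_jHE {q : ℝ} (v : ℝ) (hq0 : 0 < q) (hq1 : q < 1) (hv : -1 < v) (x : ℝ) :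
    eulerSeries q (q ^ (2 * v)) * jHE q v x =
      ∑' m : ℕ, eulerCoeff q m * (q ^ (2 * v)) ^ m * eulerSeries q ((q ^ 2) ^ m * x ^ 2) := by
  have hp0 : 0 < q ^ 2 := by positivity
  have hp1 : q ^ 2 < 1 := pow_lt_one₀ hq0.le hq1 two_ne_zero
  set a : ℝ := q ^ (2 * v) with ha
  have ha0 : 0 < a := Real.rpow_pos_of_pos hq0 _
  have haq : q ^ (2 * v + 2) = q ^ 2 * a := by
    rw [Real.rpow_add hq0, mul_comm, Real.rpow_two]
  have ha1 : q ^ 2 * a < 1 := haq ▸ Real.rpow_lt_one hq0.le hq1 (by linarith)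
  have hsum : Summable (Function.uncurry fun n m : ℕ =>
      eulerCoeff q n * (x ^ 2) ^ n * (eulerCoeff q m * ((q ^ 2) ^ n * a) ^ m)) := by
    refine Summable.of_norm_bounded
      ((summable_abs_eulerCoeff_mul_pow hq0 hq1 (x ^ 2)).mul_of_nonneg
        (summable_abs_eulerCoeff_mul_pow hq0 hq1 a)
        (fun _ => by positivity) (fun _ => by positivity)) ?_
    rintro ⟨n, m⟩
    simp only [Function.uncurry, Real.norm_eq_abs]
    rw [abs_mul, abs_mul, abs_mul, abs_pow, abs_pow]
    gcongr
    rw [abs_pow, abs_mul, abs_of_pos (pow_pos hp0 n)]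
    gcongr
    exact mul_le_of_le_one_left (abs_nonneg _) (pow_le_one₀ hp0.le hp1.le)
  calc eulerSeries q a * jHE q v x
      = ∑' n : ℕ, eulerCoeff q n * (x ^ 2) ^ n * eulerSeries q ((q ^ 2) ^ n * a) := by
        rw [jHE, ← tsum_mul_left]
        refine tsum_congr fun n => ?_
        have h1 : qPoch (q ^ 2) (q ^ 2) n ≠ 0 := (qPoch_pos hp0.le hp1 hp0.le hp1.le n).ne'
        have h2 : qPoch (q ^ 2 * a) (q ^ 2) n ≠ 0 :=
          (qPoch_pos (by positivity) ha1 hp0.le hp1.le n).ne'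
        rw [eulerSeries_eq_qPoch_mul hq0 hq1 a n, haq, eulerCoeff, ← pow_mul x]
        generalize eulerSeries q ((q ^ 2) ^ n * a) = E
        field_simp
    _ = ∑' n : ℕ, ∑' m : ℕ,
          eulerCoeff q n * (x ^ 2) ^ n * (eulerCoeff q m * ((q ^ 2) ^ n * a) ^ m) := by
        simp only [eulerSeries, tsum_mul_left]
    _ = ∑' m : ℕ, ∑' n : ℕ,
          eulerCoeff q n * (x ^ 2) ^ n * (eulerCoeff q m * ((q ^ 2) ^ n * a) ^ m) :=
        hsum.tsum_comm.symm
    _ = _ := by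
        refine tsum_congr fun m => ?_
        rw [eulerSeries, ← tsum_mul_left]
        refine tsum_congr fun n => ?_
        rw [mul_pow, mul_pow, ← pow_mul, ← pow_mul (q ^ 2) m n, mul_comm m n]
        ring

/-- On the lattice, `j_v(·,q²)` is bounded and decays faster than any geometric rate at infinity. -/
lemma exists_abs_jHE_zpow_le {q v : ℝ} (hq0 : 0 < q) (hq1 : q < 1) (hv : -1 < v)
    {b : ℝ} (hb0 : 0 < b) (hb1 : b ≤ 1) :
    ∃ C : ℝ, 0 ≤ C ∧ ∀ k : ℤ, |jHE q v (q ^ k)| ≤ C * b ^ (-k) := by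
  have hp0 : 0 < q ^ 2 := by positivity
  have hp1 : q ^ 2 < 1 := pow_lt_one₀ hq0.le hq1 two_ne_zero
  set a : ℝ := q ^ (2 * v) with ha
  have ha0 : 0 < a := Real.rpow_pos_of_pos hq0 _
  have haq : q ^ (2 * v + 2) = q ^ 2 * a := by
    rw [Real.rpow_add hq0, mul_comm, Real.rpow_two]
  have ha1 : q ^ 2 * a < 1 := haq ▸ Real.rpow_lt_one hq0.le hq1 (by linarith)
  have hE : 0 < |eulerSeries q a| := abs_pos.2 (eulerSeries_ne_zero hq0 hq1 ha0.le ha1)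
  set B : ℝ := ∑' n : ℕ, |eulerCoeff q n|
  have hB : 0 ≤ B := tsum_nonneg fun _ => abs_nonneg _
  have hS := summable_abs_eulerCoeff_mul_pow hq0 hq1 (a / b)
  set S : ℝ := ∑' n : ℕ, |eulerCoeff q n| * |a / b| ^ n
  have hS0 : 0 ≤ S := tsum_nonneg fun _ => by positivity
  refine ⟨S * B / |eulerSeries q a|, by positivity, fun k => ?_⟩
  rw [div_mul_eq_mul_div, le_div_iff₀ hE, mul_comm |jHE q v (q ^ k)|, ← abs_mul,
    eulerSeries_mul_jHE v hq0 hq1 hv, ← ha, mul_assoc]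
  refine (Real.norm_eq_abs _).symm.trans_le
    (tsum_of_norm_bounded (hS.hasSum.mul_right (B * b ^ (-k))) fun m => ?_)
  have hw : (q ^ 2) ^ m * (q ^ k) ^ 2 = (q ^ 2) ^ ((m : ℤ) + k) := by
    rw [zpow_add₀ hp0.ne', zpow_natCast, ← zpow_natCast (q ^ k) 2, ← zpow_natCast q 2, ← zpow_mul,
      ← zpow_mul, mul_comm k]
  rw [hw, norm_mul, norm_mul, norm_pow, Real.norm_eq_abs, Real.norm_eq_abs, Real.norm_eq_abs,
    abs_of_pos ha0, abs_of_pos (div_pos ha0 hb0)]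
  rcases lt_or_ge ((m : ℤ) + k) 0 with hneg | hpos
  · obtain ⟨n, hn⟩ : ∃ n : ℕ, (m : ℤ) + k = -(n + 1 : ℤ) :=
      ⟨(-((m : ℤ) + k) - 1).toNat, by omega⟩
    rw [hn, eulerSeries_zpow_neg hq0 hq1, abs_zero, mul_zero]
    positivity
  · have h1 : |eulerSeries q ((q ^ 2) ^ ((m : ℤ) + k))| ≤ B := by
      refine abs_eulerSeries_le hq0 hq1 ?_
      obtain ⟨n, hn⟩ := Int.eq_ofNat_of_zero_le hpos
      rw [hn, zpow_natCast, abs_of_pos (pow_pos hp0 n)]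
      exact pow_le_one₀ hp0.le hp1.le
    have h2 : b ^ m ≤ b ^ (-k) := by
      rw [← zpow_natCast]
      exact zpow_le_zpow_right_of_le_one₀ hb0 hb1 (by omega)
    have h3 : a ^ m = (a / b) ^ m * b ^ m := by rw [← mul_pow, div_mul_cancel₀ _ hb0.ne']
    calc |eulerCoeff q m| * a ^ m * |eulerSeries q ((q ^ 2) ^ ((m : ℤ) + k))|
        ≤ |eulerCoeff q m| * ((a / b) ^ m * b ^ (-k)) * B := by rw [h3]; gcongr
      _ = _ := by ring

lemma exists_abs_jHE_zpow_le_const {q v : ℝ} (hq0 : 0 < q) (hq1 : q < 1) (hv : -1 < v) :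
    ∃ C : ℝ, 0 ≤ C ∧ ∀ k : ℤ, |jHE q v (q ^ k)| ≤ C := by
  simpa using exists_abs_jHE_zpow_le hq0 hq1 hv one_pos le_rfl

lemma zpow_mul_zpow_rpow {q : ℝ} (hq0 : 0 < q) (v : ℝ) (n : ℤ) :
    q ^ n * (q ^ n) ^ (2 * v + 1 : ℝ) = (q ^ (2 * v + 2)) ^ n := by
  rw [← Real.rpow_intCast, ← Real.rpow_intCast, ← Real.rpow_mul hq0.le, ← Real.rpow_mul hq0.le,
    ← Real.rpow_add hq0]
  congr 1
  ring

lemma summable_jHE_mul_jHE {q v : ℝ} (hq0 : 0 < q) (hq1 : q < 1) (hv : -1 < v) (i l : ℤ) :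
    Summable fun n : ℤ => q ^ n * (q ^ n) ^ (2 * v + 1 : ℝ) *
      (|jHE q v (q ^ i * q ^ n)| * |jHE q v (q ^ l * q ^ n)|) := by
  simp only [zpow_mul_zpow_rpow hq0, ← zpow_add₀ hq0.ne']
  set a : ℝ := q ^ (2 * v + 2)
  have ha0 : 0 < a := Real.rpow_pos_of_pos hq0 _
  have ha1 : a < 1 := Real.rpow_lt_one hq0.le hq1 (by linarith)
  obtain ⟨C, hC0, hC⟩ := exists_abs_jHE_zpow_le_const hq0 hq1 hv
  obtain ⟨K, hK0, hK⟩ := exists_abs_jHE_zpow_le hq0 hq1 hv (b := a * q) (by positivity)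
    (mul_le_one₀ ha1.le hq0.le hq1.le)
  refine Summable.of_nat_of_neg ?_ ?_
  · refine Summable.of_nonneg_of_le (fun n => by positivity) (fun n => ?_)
      ((summable_geometric_of_lt_one ha0.le ha1).mul_right (C * C))
    rw [zpow_natCast]
    gcongr <;> apply hC
  · refine Summable.of_nonneg_of_le (fun n => by positivity) (fun n => ?_)
      ((summable_geometric_of_lt_one hq0.le hq1).mul_right (K * (a * q) ^ (-i) * C))
    calc a ^ (-(n : ℤ)) * (|jHE q v (q ^ (i + -(n : ℤ)))| * |jHE q v (q ^ (l + -(n : ℤ)))|)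
        ≤ a ^ (-(n : ℤ)) * (K * (a * q) ^ (-(i + -(n : ℤ))) * C) := by
          gcongr
          · apply hK
          · apply hC
      _ = q ^ n * (K * (a * q) ^ (-i) * C) := by
          have h : (a * q) ^ (-(i + -(n : ℤ))) = (a * q) ^ (-i) * (a ^ n * q ^ n) := by
            rw [neg_add, neg_neg, zpow_add₀ (by positivity), zpow_natCast, mul_pow]
          rw [h, zpow_neg, zpow_natCast]
          field_simp

/-- kernel representation of the q-translation operator. -/
theorem stmt6 (q v : ℝ) (hq0 : 0 < q) (hq1 : q < 1) (hv : -1 < v)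
    (f : ℝ → ℝ) (hf : memL1 q v f) :
    ∀ x ∈ Rq q, ∀ y ∈ Rq q,
      qTrans q v x f y =
        jackson q (fun z => f z * Dker q v x y z * z ^ (2 * v + 1 : ℝ)) := by
  rintro x ⟨i, rfl⟩ y ⟨l, rfl⟩
  set H : ℤ → ℤ → ℝ := fun n m =>
    q ^ n * (q ^ n) ^ (2 * v + 1 : ℝ) * (jHE q v (q ^ i * q ^ n) * jHE q v (q ^ l * q ^ n)) *
      (q ^ m * f (q ^ m) * (q ^ m) ^ (2 * v + 1 : ℝ)) * jHE q v (q ^ m * q ^ n) with hH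
  have hsum : Summable (Function.uncurry H) := by
    obtain ⟨C, hC0, hC⟩ := exists_abs_jHE_zpow_le_const hq0 hq1 hv
    refine Summable.of_norm_bounded
      (((summable_jHE_mul_jHE hq0 hq1 hv i l).mul_of_nonneg hf
        (fun _ => by positivity) (fun _ => by positivity)).mul_right C) ?_
    rintro ⟨n, m⟩
    have h1 : ∀ k : ℤ, |(q ^ k) ^ (2 * v + 1 : ℝ)| = (q ^ k) ^ (2 * v + 1 : ℝ) :=
      fun k => abs_of_pos (by positivity)
    have h2 : ∀ k : ℤ, |q ^ k| = q ^ k := fun k => abs_of_pos (by positivity)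
    simp only [hH, Function.uncurry, Real.norm_eq_abs, abs_mul, h1, h2]
    gcongr
    rw [← zpow_add₀ hq0.ne']
    exact hC _
  have hL : qTrans q v (q ^ i) f (q ^ l) =
      cqv q v ^ 2 * (1 - q) ^ 2 * ∑' n : ℤ, ∑' m : ℤ, H n m := by
    simp only [qTrans, qFourier, jackson, ← tsum_mul_left, ← tsum_mul_right]
    refine tsum_congr fun n => tsum_congr fun m => ?_
    rw [hH, mul_comm (q ^ n) (q ^ m)]
    ring
  have hR : jackson q (fun z => f z * Dker q v (q ^ i) (q ^ l) z * z ^ (2 * v + 1 : ℝ)) =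
      cqv q v ^ 2 * (1 - q) ^ 2 * ∑' m : ℤ, ∑' n : ℤ, H n m := by
    simp only [Dker, jackson, ← tsum_mul_left, ← tsum_mul_right]
    refine tsum_congr fun m => tsum_congr fun n => ?_
    rw [hH]
    ring
  rw [hL, hR, hsum.tsum_comm]
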